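/- J³_F(3) = {4}; that is, three STS(7)'s on a common point set whose pairwise intersections all equal the same set of k + 3 triples, 3 of which form the flower at a common point, exist exactly for k = 4 (the three systems being identical). -/

import Mathlib

/-- A Steiner triple system of order `v`: a collection of 3-element subsets of a
`v`-point set such that every 2-element subset lies in exactly one triple. -/
def IsSTS (v : ℕ) (B : Finset (Finset (Fin v))) : Prop :=
  (∀ b ∈ B, b.card = 3) ∧
  ∀ p : Finset (Fin v), p.card = 2 → ∃! b, b ∈ B ∧ p ⊆ b

/-- The flower at a point `x`: the set of all triples containing `x`. -/
def flowerAt {v : ℕ} (B : Finset (Finset (Fin v))) (x : Fin v) : Finset (Finset (Fin v)) :=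
  B.filter fun b => x ∈ b

/-- `J3F r`: the set of all `k` for which there exist three `STS(2r+1)`'s on a common
point set such that each pair of them intersects in the same set of `k + r` triples,
`r` of which form the flower at a common point. -/
def J3F (r : ℕ) : Set ℕ :=
  {k | ∃ (B₁ B₂ B₃ : Finset (Finset (Fin (2 * r + 1)))) (x : Fin (2 * r + 1)),
    IsSTS (2 * r + 1) B₁ ∧ IsSTS (2 * r + 1) B₂ ∧ IsSTS (2 * r + 1) B₃ ∧
    B₁ ∩ B₂ = B₁ ∩ B₃ ∧ B₁ ∩ B₂ = B₂ ∩ B₃ ∧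
    (B₁ ∩ B₂).card = k + r ∧
    flowerAt B₁ x = flowerAt B₂ x ∧ flowerAt B₁ x = flowerAt B₃ x ∧
    (flowerAt B₁ x).card = r}

/-- `J3 v`: the set of all `k` for which there exist three `STS(v)`'s on a common point
set pairwise intersecting in the same set of `k` triples. -/
def J3 (v : ℕ) : Set ℕ :=
  {k | ∃ (B₁ B₂ B₃ : Finset (Finset (Fin v))),
    IsSTS v B₁ ∧ IsSTS v B₂ ∧ IsSTS v B₃ ∧
    B₁ ∩ B₂ = B₁ ∩ B₃ ∧ B₁ ∩ B₂ = B₂ ∩ B₃ ∧ (B₁ ∩ B₂).card = k}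

/-- `JF r`: the set of all `k` for which there exist two `STS(2r+1)`'s on a common
point set having exactly `k + r` triples in common, `r` of them forming a common flower. -/
def JF (r : ℕ) : Set ℕ :=
  {k | ∃ (B₁ B₂ : Finset (Finset (Fin (2 * r + 1)))) (x : Fin (2 * r + 1)),
    IsSTS (2 * r + 1) B₁ ∧ IsSTS (2 * r + 1) B₂ ∧
    (B₁ ∩ B₂).card = k + r ∧
    flowerAt B₁ x = flowerAt B₂ x ∧ (flowerAt B₁ x).card = r}

/-- `S3 m`: the nonnegative integers at most `m`, with the exception of
`m-1, m-2, m-3, m-4, m-5, m-7`. -/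
def S3 (m : ℕ) : Set ℕ :=
  {k | k ≤ m ∧ k + 1 ≠ m ∧ k + 2 ≠ m ∧ k + 3 ≠ m ∧ k + 4 ≠ m ∧ k + 5 ≠ m ∧ k + 7 ≠ m}

/-- `I3F r = S3 (2r(r-1)/3)`. -/
def I3F (r : ℕ) : Set ℕ := S3 (2 * r * (r - 1) / 3)

/-- A Latin square of order `n` as a function: each row and each column is injective
(hence a permutation of the `n` symbols). -/
def IsLatin (n : ℕ) (L : Fin n → Fin n → Fin n) : Prop :=
  (∀ i, Function.Injective (L i)) ∧ (∀ j, Function.Injective fun i => L i j)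

/-- The cells where three squares all have identical entries. -/
def agreeCells (n : ℕ) (L₁ L₂ L₃ : Fin n → Fin n → Fin n) : Finset (Fin n × Fin n) :=
  Finset.univ.filter fun p => L₁ p.1 p.2 = L₂ p.1 p.2 ∧ L₂ p.1 p.2 = L₃ p.1 p.2

/-- `J3L n` (written `J'³(n)`): the set of `k` for which there exist three Latin squares
of order `n` with exactly `k` cells where all three have identical entries and all other
cells containing pairwise distinct entries in the three squares. -/
def J3L (n : ℕ) : Set ℕ :=
  {k | ∃ L₁ L₂ L₃ : Fin n → Fin n → Fin n,
    IsLatin n L₁ ∧ IsLatin n L₂ ∧ IsLatin n L₃ ∧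
    (agreeCells n L₁ L₂ L₃).card = k ∧
    ∀ p : Fin n × Fin n, p ∉ agreeCells n L₁ L₂ L₃ →
      L₁ p.1 p.2 ≠ L₂ p.1 p.2 ∧ L₁ p.1 p.2 ≠ L₃ p.1 p.2 ∧ L₂ p.1 p.2 ≠ L₃ p.1 p.2}

/-- `J3LD n` (written `J''³(n)`): as `J3L n`, but additionally the three Latin squares
share the same constant value on the secondary diagonal (cells `(i, n-1-i)`). -/
def J3LD (n : ℕ) : Set ℕ :=
  {k | ∃ L₁ L₂ L₃ : Fin n → Fin n → Fin n,
    IsLatin n L₁ ∧ IsLatin n L₂ ∧ IsLatin n L₃ ∧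
    (∃ c, ∀ i : Fin n, L₁ i i.rev = c ∧ L₂ i i.rev = c ∧ L₃ i i.rev = c) ∧
    (agreeCells n L₁ L₂ L₃).card = k ∧
    ∀ p : Fin n × Fin n, p ∉ agreeCells n L₁ L₂ L₃ →
      L₁ p.1 p.2 ≠ L₂ p.1 p.2 ∧ L₁ p.1 p.2 ≠ L₃ p.1 p.2 ∧ L₂ p.1 p.2 ≠ L₃ p.1 p.2}

/-- A pairwise balanced design `B(K, 1, v)`: blocks have sizes in `K` and every
2-element subset of the `v`-point set lies in exactly one block. -/
def IsPBD (v : ℕ) (K : Set ℕ) (A : Finset (Finset (Fin v))) : Prop :=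
  (∀ b ∈ A, b.card ∈ K) ∧
  ∀ p : Finset (Fin v), p.card = 2 → ∃! b, b ∈ A ∧ p ⊆ b

namespace IsSTS

variable {v : ℕ} {B : Finset (Finset (Fin v))}

/-- Two distinct triples of a Steiner triple system share at most one point. -/
theorem eq_or_card_inter_le_one (h : IsSTS v B) {s t : Finset (Fin v)} (hs : s ∈ B)
    (ht : t ∈ B) : s = t ∨ (s ∩ t).card ≤ 1 := by
  by_cases hc : (s ∩ t).card ≤ 1
  · exact Or.inr hc
  obtain ⟨p, hp, hp2⟩ := Finset.exists_subset_card_eq (show 2 ≤ (s ∩ t).card by omega)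
  exact Or.inl ((h.2 p hp2).unique ⟨hs, hp.trans Finset.inter_subset_left⟩
    ⟨ht, hp.trans Finset.inter_subset_right⟩)

theorem exists_mem (h : IsSTS v B) {a b : Fin v} (hab : a ≠ b) :
    ∃ s ∈ B, a ∈ s ∧ b ∈ s := by
  obtain ⟨s, ⟨hs, hsub⟩, -⟩ := h.2 {a, b} (Finset.card_pair hab)
  exact ⟨s, hs, hsub (by simp), hsub (by simp)⟩

theorem exists_third (h : IsSTS v B) {a b : Fin v} (hab : a ≠ b) :
    ∃ c, c ≠ a ∧ c ≠ b ∧ ({a, b, c} : Finset (Fin v)) ∈ B := by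
  obtain ⟨s, hs, ha, hb⟩ := h.exists_mem hab
  have hsub : ({a, b} : Finset (Fin v)) ⊆ s := by
    simp [Finset.insert_subset_iff, ha, hb]
  have hc : (s \ {a, b}).card = 1 := by
    rw [Finset.card_sdiff_of_subset hsub, h.1 s hs, Finset.card_pair hab]
  obtain ⟨c, hc⟩ := Finset.card_eq_one.1 hc
  have hcm : c ∈ s \ {a, b} := by simp [hc]
  refine ⟨c, by grind, by grind, ?_⟩
  convert hs
  grind

/-- Containment between Steiner triple systems of the same order is equality. -/
theorem eq_of_subset {F : Finset (Finset (Fin v))} (h : IsSTS v B) (hF : IsSTS v F)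
    (hsub : F ⊆ B) : B = F := by
  refine Finset.Subset.antisymm (fun s hs => ?_) hsub
  obtain ⟨p, hp, hp2⟩ := Finset.exists_subset_card_eq (show 2 ≤ s.card by simp [h.1 s hs])
  obtain ⟨t, ⟨ht, hpt⟩, -⟩ := hF.2 p hp2
  rwa [(h.2 p hp2).unique ⟨hs, hp⟩ ⟨hsub ht, hpt⟩]

/-- Relabelling the points of a Steiner triple system. -/
theorem map_perm (h : IsSTS v B) (e : Equiv.Perm (Fin v)) :
    IsSTS v (B.map e.finsetCongr.toEmbedding) := by
  refine ⟨fun b hb => ?_, fun p hp => ?_⟩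
  · obtain ⟨s, hs, rfl⟩ := Finset.mem_map.1 hb
    simp [h.1 s hs]
  · obtain ⟨s, ⟨hs, hps⟩, hu⟩ := h.2 (p.map e.symm.toEmbedding) (by simpa using hp)
    have key (t : Finset (Fin v)) :
        p ⊆ t.map e.toEmbedding ↔ p.map e.symm.toEmbedding ⊆ t := by
      simp only [Finset.subset_iff, Finset.mem_map_equiv, Equiv.symm_symm]
      exact ⟨fun H a ha => by simpa using H ha, fun H a ha => H (by simpa using ha)⟩
    refine ⟨s.map e.toEmbedding, ⟨Finset.mem_map_of_mem e.finsetCongr.toEmbedding hs,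
      (key s).2 hps⟩, ?_⟩
    rintro _ ⟨hb, hpb⟩
    obtain ⟨t, ht, rfl⟩ := Finset.mem_map.1 hb
    exact congrArg (Finset.map e.toEmbedding) (hu t ⟨ht, (key t).1 hpb⟩)

end IsSTS

/-- The flower `{0,1,2}, {0,3,4}, {0,5,6}` at the point `0`. -/
def stdFlower : Finset (Finset (Fin 7)) := {{0, 1, 2}, {0, 3, 4}, {0, 5, 6}}

/-- The Fano plane containing `stdFlower` and `{1,3,5}`. -/
def fanoEven : Finset (Finset (Fin 7)) :=
  {{0, 1, 2}, {0, 3, 4}, {0, 5, 6}, {1, 3, 5}, {1, 4, 6}, {2, 3, 6}, {2, 4, 5}}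

/-- The Fano plane containing `stdFlower` and `{1,3,6}`. -/
def fanoOdd : Finset (Finset (Fin 7)) :=
  {{0, 1, 2}, {0, 3, 4}, {0, 5, 6}, {1, 3, 6}, {1, 4, 5}, {2, 3, 5}, {2, 4, 6}}

/-- A family of triples covering all pairs, any two of which meet in at most one point,
is a Steiner triple system. -/
theorem isSTS_of_cover {v : ℕ} {B : Finset (Finset (Fin v))} (h3 : ∀ b ∈ B, b.card = 3)
    (hI : ∀ s ∈ B, ∀ t ∈ B, s = t ∨ (s ∩ t).card ≤ 1)
    (hC : ∀ a b, ∃ s ∈ B, a ∈ s ∧ b ∈ s) : IsSTS v B := by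
  refine ⟨h3, fun p hp => ?_⟩
  obtain ⟨a, b, hab, rfl⟩ := Finset.card_eq_two.1 hp
  obtain ⟨s, hs, ha, hb⟩ := hC a b
  refine ⟨s, ⟨hs, by simp [Finset.insert_subset_iff, ha, hb]⟩, ?_⟩
  rintro t ⟨ht, hpt⟩
  refine (hI t ht s hs).resolve_right fun hle => ?_
  have := Finset.card_le_card (Finset.subset_inter hpt
    (show ({a, b} : Finset (Fin v)) ⊆ s by simp [Finset.insert_subset_iff, ha, hb]))
  omega

set_option maxRecDepth 20000 in
theorem isSTS_fanoEven : IsSTS 7 fanoEven :=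
  isSTS_of_cover (by decide) (by decide) (by decide)

set_option maxRecDepth 20000 in
theorem isSTS_fanoOdd : IsSTS 7 fanoOdd :=
  isSTS_of_cover (by decide) (by decide) (by decide)

set_option maxRecDepth 20000 in
theorem triple_through_one_three : ∀ b : Finset (Fin 7), b.card = 3 → 1 ∈ b → 3 ∈ b →
    (∀ f ∈ stdFlower, f = b ∨ (f ∩ b).card ≤ 1) → b = {1, 3, 5} ∨ b = {1, 3, 6} := by
  decide

/-- A pair of points occurring in a triple of `F` lies in only one triple compatible with
`stdFlower` and the triple `s`. -/
def Forces (s : Finset (Fin 7)) (F : Finset (Finset (Fin 7))) : Prop :=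
  ∀ f ∈ F, ∃ a ∈ f, ∃ b ∈ f, a ≠ b ∧ ∀ t : Finset (Fin 7), t.card = 3 → a ∈ t → b ∈ t →
    (∀ g ∈ insert s stdFlower, g = t ∨ (g ∩ t).card ≤ 1) → t = f

theorem IsSTS.eq_of_forces {B F : Finset (Finset (Fin 7))} {s : Finset (Fin 7)}
    (h : IsSTS 7 B) (hF : IsSTS 7 F) (hB : insert s stdFlower ⊆ B) (hs : Forces s F) :
    B = F := by
  refine h.eq_of_subset hF fun f hf => ?_
  obtain ⟨a, -, b, -, hab, H⟩ := hs f hf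
  obtain ⟨t, ht, hat, hbt⟩ := h.exists_mem hab
  rwa [← H t (h.1 t ht) hat hbt fun g hg => h.eq_or_card_inter_le_one (hB hg) ht]

theorem forces_fanoEven : Forces {1, 3, 5} fanoEven := by
  unfold Forces
  decide +kernel

theorem forces_fanoOdd : Forces {1, 3, 6} fanoOdd := by
  unfold Forces
  decide +kernel

/-- A Steiner triple system of order 7 containing `stdFlower` is one of two Fano planes. -/
theorem IsSTS.eq_fano {B : Finset (Finset (Fin 7))} (h : IsSTS 7 B) (hB : stdFlower ⊆ B) :
    B = fanoEven ∨ B = fanoOdd := by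
  obtain ⟨b, hb, h1, h3⟩ := h.exists_mem (show (1 : Fin 7) ≠ 3 by decide)
  rcases triple_through_one_three b (h.1 b hb) h1 h3
    fun f hf => h.eq_or_card_inter_le_one (hB hf) hb with rfl | rfl
  · exact Or.inl (h.eq_of_forces isSTS_fanoEven (Finset.insert_subset hb hB) forces_fanoEven)
  · exact Or.inr (h.eq_of_forces isSTS_fanoOdd (Finset.insert_subset hb hB) forces_fanoOdd)

/-- The points of a Steiner triple system of order 7 can be labelled so that the flower at
any given point becomes `stdFlower`. -/
theorem IsSTS.exists_perm_flower {B : Finset (Finset (Fin 7))} (h : IsSTS 7 B) (x : Fin 7) :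
    ∃ e : Equiv.Perm (Fin 7),
      stdFlower ⊆ (flowerAt B x).map e.finsetCongr.toEmbedding := by
  have avoid (s : Finset (Fin 7)) (hs : s.card < 7) : ∃ a, a ∉ s := by
    by_contra! H
    have := (Finset.eq_univ_iff_forall.2 H)
    simp [this] at hs
  have meet {a b c d : Fin 7} (hs : {x, a, b} ∈ B) (ht : {x, c, d} ∈ B)
      (hac : c ∉ ({x, a, b} : Finset (Fin 7))) (hxd : d ≠ x) :
      d ∉ ({x, a, b} : Finset (Fin 7)) := by
    intro hd
    rcases h.eq_or_card_inter_le_one hs ht with he | hle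
    · exact hac (he ▸ by simp)
    · have := Finset.card_le_card (show ({x, d} : Finset (Fin 7)) ⊆ {x, a, b} ∩ {x, c, d} by
        grind)
      rw [Finset.card_pair hxd.symm] at this
      omega
  obtain ⟨y, hy⟩ := avoid {x} (by simp)
  obtain ⟨y', hy1, hy2, hyB⟩ := h.exists_third (show x ≠ y by grind)
  obtain ⟨z, hz⟩ := avoid {x, y, y'} (Finset.card_le_three.trans_lt (by norm_num))
  obtain ⟨z', hz1, hz2, hzB⟩ := h.exists_third (show x ≠ z by grind)
  obtain ⟨w, hw⟩ := avoid {x, y, y', z, z'} (Finset.card_le_five.trans_lt (by norm_num))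
  obtain ⟨w', hw1, hw2, hwB⟩ := h.exists_third (show x ≠ w by grind)
  have hzy := meet hyB hzB hz hz1
  have hwy := meet hyB hwB (fun H => hw (by clear * - H; grind)) hw1
  have hwz := meet hzB hwB (fun H => hw (by clear * - H; grind)) hw1
  have hinj : Function.Injective ![x, y, y', z, z', w, w'] := by
    rw [← List.nodup_ofFn]
    simp only [Finset.mem_insert, Finset.mem_singleton, not_or] at hy hz hw hzy hwy hwz
    clear meet avoid hyB hzB hwB
    simp [List.ofFn_succ]
    grind
  let e := Equiv.ofBijective _ (Finite.injective_iff_bijective.1 hinj)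
  have he (s : Finset (Fin 7)) (hs : s.image ![x, y, y', z, z', w, w'] ∈ flowerAt B x) :
      s ∈ (flowerAt B x).map e.symm.finsetCongr.toEmbedding := by
    rw [Finset.mem_map_equiv]
    convert hs
    simp [Finset.map_eq_image, e]
  refine ⟨e.symm, fun s hs => he s ?_⟩
  simp only [stdFlower, Finset.mem_insert, Finset.mem_singleton] at hs
  rcases hs with rfl | rfl | rfl <;>
    simp [flowerAt, Finset.image_insert, hyB, hzB, hwB]

theorem IsSTS.card_eq_seven {B : Finset (Finset (Fin 7))} (h : IsSTS 7 B) : B.card = 7 := by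
  obtain ⟨e, he⟩ := h.exists_perm_flower 0
  rw [← Finset.card_map e.finsetCongr.toEmbedding]
  rcases (h.map_perm e).eq_fano (he.trans (Finset.map_subset_map.2 (Finset.filter_subset _ _)))
    with H | H <;> rw [H] <;> decide

/-- `J³_F(3) = {4}`. -/
theorem stmt14 : J3F 3 = {4} := by
  ext k
  rw [Set.mem_singleton_iff]
  constructor
  · rintro ⟨B₁, B₂, B₃, x, h₁, h₂, h₃, h12, h13, hk, hx2, hx3, -⟩
    change IsSTS 7 B₁ at h₁
    change IsSTS 7 B₂ at h₂
    change IsSTS 7 B₃ at h₃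
    obtain ⟨e, he⟩ := h₁.exists_perm_flower x
    have key {B : Finset (Finset (Fin 7))} (h : IsSTS 7 B)
        (hx : flowerAt B₁ x = flowerAt B x) :
        B.map e.finsetCongr.toEmbedding = fanoEven ∨
          B.map e.finsetCongr.toEmbedding = fanoOdd := by
      refine (h.map_perm e).eq_fano (he.trans (Finset.map_subset_map.2 ?_))
      exact hx ▸ Finset.filter_subset _ _
    have inj := Finset.map_injective e.finsetCongr.toEmbedding
    have hpig : B₁ = B₂ ∨ B₁ = B₃ ∨ B₂ = B₃ := by
      rcases key h₁ rfl with a | a <;> rcases key h₂ hx2 with b | b <;>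
        rcases key h₃ hx3 with c | c
      all_goals first
        | exact Or.inl (inj (a.trans b.symm))
        | exact Or.inr (Or.inl (inj (a.trans c.symm)))
        | exact Or.inr (Or.inr (inj (b.trans c.symm)))
    have c₁ := h₁.card_eq_seven
    have c₂ := h₂.card_eq_seven
    rcases hpig with rfl | rfl | rfl
    · rw [Finset.inter_self] at hk
      omega
    · rw [h12, Finset.inter_self] at hk
      omega
    · rw [h13, Finset.inter_self] at hk
      omega
  · rintro rfl
    exact ⟨fanoEven, fanoEven, fanoEven, (0 : Fin 7), isSTS_fanoEven, isSTS_fanoEven,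
      isSTS_fanoEven, rfl, rfl, by decide, rfl, rfl, by decide⟩
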